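/- Let W and W' be non-negative real random variables on the same probability space with the same distribution, let D := W' − W, and suppose E(D|W) = −λ(W − 1) almost surely for a fixed constant λ > 0. Assume either that W is strictly positive almost surely, or that W is non-negative and assumes only finitely many values. Then for every t > 0 and every κ > 0, E(D²·1[|W − t| ≤ |D|]) ≤ 16λ²κ² + 1040·λ^{3/2}·E|W − 1|·κ·√t + 8λ·ε₂(t/3)·t + ε₁(t), where ε₁(t) := E[ E(D²|W) · 1[E(D²|W) > 2λ(W + t) or E(D⁴|W) > 4λ²(κ²W² + κ²t²)] ] and ε₂(t) := P[ E(D²|W) < 2λ(W − t/4) or E(D⁴|W) > 4λ²(κ²W² + κ²t²) ]. -/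

import Mathlib

open MeasureTheory Real

/-- The antiderivative of `arctan` vanishing at `0`. -/
noncomputable def arctanPrimitive (y : ℝ) : ℝ := y * arctan y - log (1 + y ^ 2) / 2

theorem hasDerivAt_arctanPrimitive (y : ℝ) : HasDerivAt arctanPrimitive (arctan y) y := by
  have hpos : (1 + y ^ 2 : ℝ) ≠ 0 := by positivity
  have h₁ := (hasDerivAt_id y).mul (hasDerivAt_arctan y)
  have h₂ := ((((hasDerivAt_id y).pow 2).const_add 1).log (by simpa using hpos)).div_const 2
  have h := h₁.sub h₂
  refine h.congr_deriv ?_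
  simp only [id_eq, Pi.pow_apply]
  field_simp
  ring

theorem arctanPrimitive_neg (y : ℝ) : arctanPrimitive (-y) = arctanPrimitive y := by
  simp [arctanPrimitive, arctan_neg]

theorem monotoneOn_of_hasDerivAt_nonneg {f f' : ℝ → ℝ} {s : Set ℝ} (hs : Convex ℝ s)
    (hf : ∀ x, HasDerivAt f (f' x) x) (hf' : ∀ x ∈ s, 0 ≤ f' x) : MonotoneOn f s :=
  monotoneOn_of_deriv_nonneg hs (fun x _ => (hf x).continuousAt.continuousWithinAt)
    (fun x _ => (hf x).differentiableAt.differentiableWithinAt)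
    fun x hx => by rw [(hf x).deriv]; exact hf' x (interior_subset hx)

theorem arctan_add_sub_arctan_ge {y d : ℝ} (hd : d ∈ Set.Icc (0 : ℝ) 1) :
    3 / 8 * (d / (1 + y ^ 2)) ≤ arctan (y + d) - arctan y := by
  have hmono : MonotoneOn (fun d => arctan (y + d) - 3 / 8 * (d / (1 + y ^ 2)))
      (Set.Icc (0 : ℝ) 1) := by
    refine monotoneOn_of_hasDerivAt_nonneg (convex_Icc 0 1)
      (f' := fun d => 1 / (1 + (y + d) ^ 2) - 3 / 8 * (1 / (1 + y ^ 2))) (fun x => ?_)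
      fun x hx => ?_
    · have h₁ := (hasDerivAt_arctan (y + x)).comp_const_add y x
      exact h₁.sub (((hasDerivAt_id x).div_const _).const_mul _)
    · have : 3 / 8 * (1 / (1 + y ^ 2)) ≤ 1 / (1 + (y + x) ^ 2) := by
        rw [mul_one_div, div_le_div_iff₀ (by positivity) (by positivity)]
        nlinarith [sq_nonneg (5 * y - 3 * x), mul_nonneg hx.1 (sub_nonneg.2 hx.2), hx.1, hx.2]
      exact sub_nonneg.2 this
  have := hmono (Set.left_mem_Icc.2 zero_le_one) hd hd.1
  simp at this
  linarith

theorem arctanPrimitive_taylor_nonneg_of_nonneg {y d : ℝ} (hd : 0 ≤ d) :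
    0 ≤ arctanPrimitive (y + d) - arctanPrimitive y - d * arctan y := by
  have hmono : MonotoneOn (fun d => arctanPrimitive (y + d) - d * arctan y) (Set.Ici (0 : ℝ)) := by
    refine monotoneOn_of_hasDerivAt_nonneg (convex_Ici 0)
      (f' := fun d => arctan (y + d) - 1 * arctan y) (fun x => ?_) fun x hx => ?_
    · exact ((hasDerivAt_arctanPrimitive (y + x)).comp_const_add y x).sub
        ((hasDerivAt_id x).mul_const _)
    · have := arctan_strictMono.monotone (le_add_of_nonneg_right hx : y ≤ y + x)
      linarith
  have := hmono Set.self_mem_Ici hd hd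
  simp at this
  linarith

theorem arctanPrimitive_taylor_ge_of_mem_Icc {y d : ℝ} (hd : d ∈ Set.Icc (0 : ℝ) 1) :
    3 / 16 * (d ^ 2 / (1 + y ^ 2)) ≤
      arctanPrimitive (y + d) - arctanPrimitive y - d * arctan y := by
  have hmono : MonotoneOn
      (fun d => arctanPrimitive (y + d) - d * arctan y - 3 / 16 * (d ^ 2 / (1 + y ^ 2)))
      (Set.Icc (0 : ℝ) 1) := by
    refine monotoneOn_of_hasDerivAt_nonneg (convex_Icc 0 1)
      (f' := fun d => arctan (y + d) - 1 * arctan y -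
        3 / 16 * ((2 : ℕ) * d ^ (2 - 1) * 1 / (1 + y ^ 2))) (fun x => ?_) fun x hx => ?_
    · exact (((hasDerivAt_arctanPrimitive (y + x)).comp_const_add y x).sub
        ((hasDerivAt_id x).mul_const _)).sub
          ((((hasDerivAt_id x).pow 2).div_const _).const_mul _)
    · have := arctan_add_sub_arctan_ge (y := y) hx
      have h : 3 / 16 * ((2 : ℕ) * x ^ (2 - 1) * 1 / (1 + y ^ 2)) =
          3 / 8 * (x / (1 + y ^ 2)) := by
        norm_num
        ring
      rw [h]
      linarith
  have := hmono (Set.left_mem_Icc.2 zero_le_one) hd hd.1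
  simp at this
  linarith

theorem arctanPrimitive_taylor_ge (y d : ℝ) {c : ℝ} (hc : 0 ≤ c) (hcy : c ≤ 1 / (1 + y ^ 2)) :
    3 / 16 * ((d ^ 2 - d ^ 4) * c) ≤
      arctanPrimitive (y + d) - arctanPrimitive y - d * arctan y := by
  wlog hd : 0 ≤ d generalizing y d
  · have := this (-y) (-d) (by simpa using hcy) (by linarith)
    rw [← neg_add, arctanPrimitive_neg, arctanPrimitive_neg, arctan_neg, neg_mul_neg] at this
    simpa [Even.neg_pow (by decide : Even 4)] using this
  rcases le_total d 1 with hd1 | hd1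
  · refine le_trans ?_ (arctanPrimitive_taylor_ge_of_mem_Icc ⟨hd, hd1⟩)
    have : d ^ 2 * c ≤ d ^ 2 * (1 / (1 + y ^ 2)) := by gcongr
    rw [mul_one_div] at this
    nlinarith [mul_nonneg (by positivity : 0 ≤ d ^ 4) hc]
  · refine le_trans ?_ (arctanPrimitive_taylor_nonneg_of_nonneg hd)
    have : d ^ 2 - d ^ 4 ≤ 0 := by nlinarith [sq_nonneg d, one_le_pow₀ hd1 (n := 2)]
    nlinarith [mul_nonneg (neg_nonneg.2 this) hc]

theorem abs_arctan_le (y : ℝ) : |arctan y| ≤ 8 / 5 := by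
  have := pi_lt_d2
  rw [abs_le]
  constructor <;> linarith [neg_pi_div_two_lt_arctan y, arctan_lt_pi_div_two y]

theorem abs_arctanPrimitive_le (y : ℝ) : |arctanPrimitive y| ≤ 8 / 5 * |y| := by
  have h₀ : arctanPrimitive 0 = 0 := by simp [arctanPrimitive]
  have := Convex.norm_image_sub_le_of_norm_hasDerivWithin_le (s := Set.univ) (C := 8 / 5)
    (fun x _ => (hasDerivAt_arctanPrimitive x).hasDerivWithinAt) (fun x _ => abs_arctan_le x)
    convex_univ (Set.mem_univ 0) (Set.mem_univ y)
  simpa [h₀] using this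

section CondExp

variable {Ω : Type*} {m m₀ : MeasurableSpace Ω} {μ : Measure Ω} [IsFiniteMeasure μ]

theorem integral_mul_condExp_of_bounded (hm : m ≤ m₀) {c g : Ω → ℝ} {C : ℝ}
    (hc : StronglyMeasurable[m] c) (hC : ∀ ω, |c ω| ≤ C) (hg : Integrable g μ) :
    ∫ ω, c ω * (μ[g | m]) ω ∂μ = ∫ ω, c ω * g ω ∂μ := by
  have hcg : Integrable (c * g) μ :=
    hg.bdd_mul (hc.mono hm).aestronglyMeasurable (ae_of_all _ hC)
  rw [← integral_condExp hm (f := fun ω => c ω * g ω)]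
  exact integral_congr_ae (condExp_mul_of_stronglyMeasurable_left hc hcg hg).symm

/-- A concentration inequality for an equally distributed pair `(W, W + D)` with linear
regression of `D` on `W`, tested against the Cauchy kernel of scale `δ` centred at `t`. -/
theorem integral_cauchy_kernel_le (hm : m ≤ m₀) {W W' D : Ω → ℝ} {lam t δ : ℝ}
    (hWm : Measurable[m] W) (hW' : Measurable W') (hD : ∀ ω, W' ω = W ω + D ω)
    (hdist : μ.map W = μ.map W') (hlam : 0 ≤ lam) (hδ : 0 < δ)
    (hD1 : Integrable D μ) (hD2 : Integrable (fun ω => D ω ^ 2) μ)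
    (hD4 : Integrable (fun ω => D ω ^ 4) μ) (hW1 : Integrable (fun ω => |W ω - 1|) μ)
    (hcond : μ[D | m] =ᵐ[μ] fun ω => -lam * (W ω - 1))
    {c : Ω → ℝ} (hcm : StronglyMeasurable[m] c) (hc : ∀ ω, 0 ≤ c ω)
    (hcW : ∀ ω, c ω ≤ 1 / (1 + ((W ω - t) / δ) ^ 2)) :
    ∫ ω, c ω * (D ω ^ 2 - D ω ^ 4 / δ ^ 2) ∂μ ≤ 128 / 15 * (δ * lam * ∫ ω, |W ω - 1| ∂μ) := by
  have hW : Measurable W := hWm.mono hm le_rfl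
  have hPm : Measurable fun x => arctanPrimitive ((x - t) / δ) := by
    unfold arctanPrimitive
    fun_prop
  have hc1 : ∀ ω, |c ω| ≤ 1 := fun ω => by
    rw [abs_of_nonneg (hc ω)]
    refine (hcW ω).trans ?_
    rw [div_le_one (by positivity)]
    nlinarith [sq_nonneg ((W ω - t) / δ)]
  have hWsub : Integrable (fun ω => W ω - 1) μ := by
    refine hW1.mono (hW.sub_const 1).aestronglyMeasurable (ae_of_all _ fun ω => ?_)
    simp
  have hWi : Integrable W μ := 
    (hWsub.add (integrable_const 1)).congr (ae_of_all _ fun ω => by simp)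
  have hPW : ∀ {X : Ω → ℝ}, Integrable X μ → Measurable X →
      Integrable (fun ω => arctanPrimitive ((X ω - t) / δ)) μ := fun {X} hX hXm => by
    refine (((hX.sub (integrable_const t)).div_const δ).const_mul (8 / 5)).mono
      (hPm.comp hXm).aestronglyMeasurable (ae_of_all _ fun ω => ?_)
    simpa [abs_mul, abs_div] using abs_arctanPrimitive_le ((X ω - t) / δ)
  have hW'i : Integrable W' μ := by
    rw [funext hD]
    exact hWi.add hD1
  have hEq : ∫ ω, arctanPrimitive ((W' ω - t) / δ) ∂μ = ∫ ω, arctanPrimitive ((W ω - t) / δ) ∂μ := by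
    rw [← integral_map (f := fun x => arctanPrimitive ((x - t) / δ)) hW'.aemeasurable
        hPm.aestronglyMeasurable,
      ← integral_map (f := fun x => arctanPrimitive ((x - t) / δ)) hW.aemeasurable
        hPm.aestronglyMeasurable, hdist]
  have haMeas : StronglyMeasurable[m] fun ω => arctan ((W ω - t) / δ) :=
    (measurable_arctan.comp ((hWm.sub_const t).div_const δ)).stronglyMeasurable
  have haD : ∫ ω, arctan ((W ω - t) / δ) * D ω ∂μ =
      ∫ ω, arctan ((W ω - t) / δ) * (-lam * (W ω - 1)) ∂μ := by
    rw [← integral_mul_condExp_of_bounded hm haMeas (fun ω => abs_arctan_le _) hD1]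
    refine integral_congr_ae ?_
    filter_upwards [hcond] with ω hω
    rw [hω]
  have haDi : Integrable (fun ω => arctan ((W ω - t) / δ) * D ω) μ :=
    hD1.bdd_mul (haMeas.mono hm).aestronglyMeasurable (ae_of_all _ fun ω => abs_arctan_le _)
  have haWi : Integrable (fun ω => arctan ((W ω - t) / δ) * (-lam * (W ω - 1))) μ :=
    (hWsub.const_mul _).bdd_mul (haMeas.mono hm).aestronglyMeasurable
      (ae_of_all _ fun ω => abs_arctan_le _)
  have hlower : -(8 / 5 * lam * ∫ ω, |W ω - 1| ∂μ) ≤ ∫ ω, arctan ((W ω - t) / δ) * D ω ∂μ := by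
    rw [haD, ← integral_const_mul, ← integral_neg]
    refine integral_mono (hW1.const_mul _).neg haWi fun ω => ?_
    have h := abs_le.1 (abs_mul (arctan ((W ω - t) / δ)) (W ω - 1)).le
    have h' := mul_le_mul_of_nonneg_right (abs_arctan_le ((W ω - t) / δ)) (abs_nonneg (W ω - 1))
    have := mul_le_mul_of_nonneg_left (h.2.trans h') hlam
    simp only
    nlinarith
  have hKi : Integrable (fun ω => c ω * (D ω ^ 2 - D ω ^ 4 / δ ^ 2)) μ :=
    (hD2.sub (hD4.div_const _)).bdd_mul (hcm.mono hm).aestronglyMeasurable (ae_of_all _ hc1)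
  have hpoint : ∀ ω, 3 / 16 * (c ω * (D ω ^ 2 - D ω ^ 4 / δ ^ 2)) ≤
      δ ^ 2 * (arctanPrimitive ((W' ω - t) / δ) - arctanPrimitive ((W ω - t) / δ)) -
        δ * (arctan ((W ω - t) / δ) * D ω) := fun ω => by
    have h := mul_le_mul_of_nonneg_left
      (arctanPrimitive_taylor_ge ((W ω - t) / δ) (D ω / δ) (hc ω) (hcW ω)) (sq_nonneg δ)
    have hy : (W ω - t) / δ + D ω / δ = (W' ω - t) / δ := by rw [hD]; ring
    rw [hy] at h
    have hl : δ ^ 2 * (3 / 16 * (((D ω / δ) ^ 2 - (D ω / δ) ^ 4) * c ω)) =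
        3 / 16 * (c ω * (D ω ^ 2 - D ω ^ 4 / δ ^ 2)) := by field_simp
    have hr : δ ^ 2 * (D ω / δ * arctan ((W ω - t) / δ)) =
        δ * (arctan ((W ω - t) / δ) * D ω) := by field_simp
    rw [hl, mul_sub _ _ (D ω / δ * _), hr] at h
    exact h
  have hPd : Integrable (fun ω => arctanPrimitive ((W' ω - t) / δ) -
      arctanPrimitive ((W ω - t) / δ)) μ := (hPW hW'i hW').sub (hPW hWi hW)
  have hint := integral_mono (hKi.const_mul (3 / 16))
    ((hPd.const_mul (δ ^ 2)).sub (haDi.const_mul δ)) hpoint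
  simp only [Pi.sub_apply] at hint
  rw [integral_const_mul, integral_sub (hPd.const_mul (δ ^ 2)) (haDi.const_mul δ),
    integral_const_mul, integral_const_mul, integral_sub (hPW hW'i hW') (hPW hWi hW), hEq] at hint
  have := mul_le_mul_of_nonneg_left hlower hδ.le
  linarith

theorem measurableSet_moment_gt {W v q : Ω → ℝ} (hW : Measurable[m] W)
    (hv : Measurable[m] v) (hq : Measurable[m] q) (lam κ t : ℝ) :
    MeasurableSet[m] {ω | 2 * lam * (W ω + t) < v ω ∨
      4 * lam ^ 2 * (κ ^ 2 * W ω ^ 2 + κ ^ 2 * t ^ 2) < q ω} :=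
  (measurableSet_lt ((hW.add_const t).const_mul _) hv).union
    (measurableSet_lt ((((hW.pow_const 2).const_mul _).add_const _).const_mul _) hq)

theorem measurableSet_moment_lt {W v q : Ω → ℝ} (hW : Measurable[m] W)
    (hv : Measurable[m] v) (hq : Measurable[m] q) (lam κ t : ℝ) :
    MeasurableSet[m] {ω | v ω < 2 * lam * (W ω - t / 4) ∨
      4 * lam ^ 2 * (κ ^ 2 * W ω ^ 2 + κ ^ 2 * t ^ 2) < q ω} :=
  (measurableSet_lt hv ((hW.sub_const _).const_mul _)).union
    (measurableSet_lt ((((hW.pow_const 2).const_mul _).add_const _).const_mul _) hq)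

end CondExp

theorem sq_le_kernel_mul {d x δ : ℝ} (hδ : 0 < δ) (h : |x| ≤ |d|) :
    d ^ 2 ≤ 1 / (1 + (x / δ) ^ 2) * (d ^ 2 + d ^ 4 / δ ^ 2) := by
  have hx : x ^ 2 ≤ d ^ 2 := sq_le_sq.2 h
  rw [one_div_mul_eq_div, le_div_iff₀ (by positivity), div_pow]
  have : d ^ 2 * x ^ 2 / δ ^ 2 ≤ d ^ 2 * d ^ 2 / δ ^ 2 := by gcongr
  calc d ^ 2 * (1 + x ^ 2 / δ ^ 2) = d ^ 2 + d ^ 2 * x ^ 2 / δ ^ 2 := by ring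
    _ ≤ d ^ 2 + d ^ 2 * d ^ 2 / δ ^ 2 := by gcongr
    _ = _ := by ring

theorem sq_le_inv_sq_mul {d x : ℝ} (hx0 : x ≠ 0) (h : |x| ≤ |d|) :
    d ^ 2 ≤ 1 / x ^ 2 * d ^ 4 := by
  have hx : x ^ 2 ≤ d ^ 2 := sq_le_sq.2 h
  rw [one_div_mul_eq_div, le_div_iff₀ (by positivity)]
  nlinarith [sq_nonneg d]

theorem inv_sq_mul_le_of_far {w t κ lam q : ℝ} (ht : 0 < t)
    (hw : ¬(t / 3 ≤ w ∧ w ≤ 3 * t))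
    (hq : q ≤ 4 * lam ^ 2 * (κ ^ 2 * w ^ 2 + κ ^ 2 * t ^ 2)) :
    1 / (w - t) ^ 2 * q ≤ 10 * lam ^ 2 * κ ^ 2 := by
  have hne : w - t ≠ 0 := fun h => hw ⟨by linarith, by linarith⟩
  have hquad : 0 ≤ (3 * w - t) * (w - 3 * t) := by
    by_cases h : t / 3 ≤ w
    · have : 3 * t < w := by by_contra! h'; exact hw ⟨h, h'⟩
      exact mul_nonneg (by linarith) (by linarith)
    · exact mul_nonneg_of_nonpos_of_nonpos (by linarith) (by linarith)
  rw [one_div_mul_eq_div, div_le_iff₀ (by positivity)]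
  nlinarith [mul_nonneg (mul_nonneg (sq_nonneg lam) (sq_nonneg κ)) hquad]

/-- On `[t/3, 3t]`, the upper moment bounds at scale `t` and the lower ones at scale `t/3` make
the truncated second moment comparable with the full one. -/
theorem moment_add_le_mul_moment_sub {w t κ lam v q δ : ℝ} (ht : 0 < t) (hκ : 0 < κ)
    (hlam : 0 < lam) (hδ : δ ^ 2 = 8 * lam * κ ^ 2 * t) (hw : t / 3 ≤ w ∧ w ≤ 3 * t)
    (hv : v ≤ 2 * lam * (w + t))
    (hq : q ≤ 4 * lam ^ 2 * (κ ^ 2 * w ^ 2 + κ ^ 2 * t ^ 2))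
    (hv' : 2 * lam * (w - t / 3 / 4) ≤ v)
    (hq' : q ≤ 4 * lam ^ 2 * (κ ^ 2 * w ^ 2 + κ ^ 2 * (t / 3) ^ 2)) :
    v + q / δ ^ 2 ≤ 234 / 7 * (v - q / δ ^ 2) := by
  obtain ⟨hw₁, hw₂⟩ := hw
  have hδ0 : 0 < δ ^ 2 := by rw [hδ]; positivity
  have hup : v + q / δ ^ 2 ≤ 13 * lam * t := by
    have : q / δ ^ 2 ≤ 5 * lam * t := by
      rw [div_le_iff₀ hδ0, hδ]
      have : w ^ 2 ≤ 9 * t ^ 2 := by nlinarith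
      have := mul_le_mul_of_nonneg_left this (by positivity : 0 ≤ 4 * lam ^ 2 * κ ^ 2)
      linarith
    nlinarith
  have hlow : 7 / 18 * lam * t ≤ v - q / δ ^ 2 := by
    have : q / δ ^ 2 ≤ 2 * lam * (w - t / 3 / 4) - 7 / 18 * lam * t := by
      rw [div_le_iff₀ hδ0, hδ]
      have : 0 ≤ (w - t / 3) * (11 * t / 3 - w) := mul_nonneg (by linarith) (by linarith)
      have := mul_nonneg (by positivity : 0 ≤ 4 * lam ^ 2 * κ ^ 2) this
      nlinarith
    linarith
  linarith



/-- Theorem 3.1 (tool3). -/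
theorem tool3
    {Ω : Type*} [MeasurableSpace Ω] {μ : Measure Ω} [IsProbabilityMeasure μ]
    (W W' : Ω → ℝ) (hW : Measurable W) (hW' : Measurable W')
    (hWnn : ∀ ω, 0 ≤ W ω) (hW'nn : ∀ ω, 0 ≤ W' ω)
    (hdist : μ.map W = μ.map W')
    (lam : ℝ) (hlam : 0 < lam)
    (D : Ω → ℝ) (hDdef : D = fun ω => W' ω - W ω)
    (hD1 : Integrable D μ)
    (hD2 : Integrable (fun ω => (D ω) ^ 2) μ)
    (hD4 : Integrable (fun ω => (D ω) ^ 4) μ)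
    (hW1 : Integrable (fun ω => |W ω - 1|) μ)
    (hcond : μ[D | MeasurableSpace.comap W inferInstance] =ᵐ[μ] fun ω => -lam * (W ω - 1))
    (hWalt : (∀ᵐ ω ∂μ, 0 < W ω) ∨ (Set.range W).Finite)
    (t : ℝ) (ht : 0 < t) (κ : ℝ) (hκ : 0 < κ) :
    (∫ ω, (D ω) ^ 2 * Set.indicator {ω' | |W ω' - t| ≤ |D ω'|} (fun _ => (1 : ℝ)) ω ∂μ) ≤
      16 * lam ^ 2 * κ ^ 2
      + 1040 * lam ^ ((3 : ℝ) / 2) * (∫ ω, |W ω - 1| ∂μ) * κ * Real.sqrt t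
      + 8 * lam *
          (μ {ω | (μ[(fun ω' => (D ω') ^ 2) | MeasurableSpace.comap W inferInstance]) ω <
                2 * lam * (W ω - (t / 3) / 4) ∨
              4 * lam ^ 2 * (κ ^ 2 * (W ω) ^ 2 + κ ^ 2 * (t / 3) ^ 2) <
                (μ[(fun ω' => (D ω') ^ 4) | MeasurableSpace.comap W inferInstance]) ω}).toReal * t
      + (∫ ω, (μ[(fun ω' => (D ω') ^ 2) | MeasurableSpace.comap W inferInstance]) ω *
          Set.indicator
            {ω' | 2 * lam * (W ω' + t) <
                (μ[(fun ω'' => (D ω'') ^ 2) | MeasurableSpace.comap W inferInstance]) ω' ∨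
              4 * lam ^ 2 * (κ ^ 2 * (W ω') ^ 2 + κ ^ 2 * t ^ 2) <
                (μ[(fun ω'' => (D ω'') ^ 4) | MeasurableSpace.comap W inferInstance]) ω'}
            (fun _ => (1 : ℝ)) ω ∂μ) := by
  classical
  set m : MeasurableSpace Ω := MeasurableSpace.comap W inferInstance
  set v := μ[(fun ω' => (D ω') ^ 2) | m] with hv_def
  set q := μ[(fun ω' => (D ω') ^ 4) | m]
  set B₁ : Set Ω := {ω' | 2 * lam * (W ω' + t) < v ω' ∨
    4 * lam ^ 2 * (κ ^ 2 * (W ω') ^ 2 + κ ^ 2 * t ^ 2) < q ω'}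
  set B₂ : Set Ω := {ω | v ω < 2 * lam * (W ω - (t / 3) / 4) ∨
    4 * lam ^ 2 * (κ ^ 2 * (W ω) ^ 2 + κ ^ 2 * (t / 3) ^ 2) < q ω}
  have hm := hW.comap_le
  change m ≤ _ at hm
  have hWm : Measurable[m] W := comap_measurable W
  have hvm : Measurable[m] v := stronglyMeasurable_condExp.measurable
  have hqm : Measurable[m] q := stronglyMeasurable_condExp.measurable
  have hB₁m : MeasurableSet[m] B₁ := measurableSet_moment_gt hWm hvm hqm lam κ t
  have hB₂m : MeasurableSet[m] B₂ := measurableSet_moment_lt hWm hvm hqm lam κ (t / 3)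
  let N : Set Ω := W ⁻¹' Set.Icc (t / 3) (3 * t)
  have hNm : MeasurableSet[m] N := hWm measurableSet_Icc
  obtain ⟨δ, hδ, hδ2, hδ3⟩ : ∃ δ : ℝ, 0 < δ ∧ δ ^ 2 = 8 * lam * κ ^ 2 * t ∧
      δ * lam ≤ 3 * (lam ^ ((3 : ℝ) / 2) * κ * √t) := by
    refine ⟨√8 * (√lam * κ * √t), by positivity, ?_, ?_⟩
    · simp only [mul_pow, sq_sqrt hlam.le, sq_sqrt ht.le, sq_sqrt (by norm_num : (0 : ℝ) ≤ 8)]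
      ring
    · have h8 : √8 ≤ 3 := (sqrt_le_left (by norm_num)).2 (by norm_num)
      have hpow : lam ^ ((3 : ℝ) / 2) = √lam * lam := by
        rw [sqrt_eq_rpow, ← rpow_add_one hlam.ne']
        norm_num
      rw [hpow]
      have := mul_le_mul_of_nonneg_right h8 (by positivity : 0 ≤ √lam * κ * √t * lam)
      linarith
  let c₀ : Ω → ℝ := B₁.indicator fun _ => 1
  let c₁ : Ω → ℝ := (B₁ᶜ ∩ N ∩ B₂).indicator fun _ => 1
  let c₂ : Ω → ℝ := (B₁ᶜ ∩ Nᶜ).indicator fun ω => 1 / (W ω - t) ^ 2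
  let c₃ : Ω → ℝ := (B₁ᶜ ∩ N ∩ B₂ᶜ).indicator fun ω => 1 / (1 + ((W ω - t) / δ) ^ 2)
  have hc₀m : StronglyMeasurable[m] c₀ := stronglyMeasurable_const.indicator hB₁m
  have hc₁m : StronglyMeasurable[m] c₁ :=
    stronglyMeasurable_const.indicator ((hB₁m.compl.inter hNm).inter hB₂m)
  have hc₂m : StronglyMeasurable[m] c₂ :=
    (((hWm.sub_const t).pow_const 2).const_div 1).stronglyMeasurable.indicator
      (hB₁m.compl.inter hNm.compl)
  have hc₃m : StronglyMeasurable[m] c₃ :=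
    (((((hWm.sub_const t).div_const δ).pow_const 2).const_add 1).const_div
      1).stronglyMeasurable.indicator ((hB₁m.compl.inter hNm).inter hB₂m.compl)
  have hc₀b : ∀ ω, |c₀ ω| ≤ 1 := fun ω => by
    simp only [c₀, Set.indicator_apply]; split_ifs <;> simp
  have hc₁b : ∀ ω, |c₁ ω| ≤ 1 := fun ω => by
    simp only [c₁, Set.indicator_apply]; split_ifs <;> simp
  have hc₂b : ∀ ω, |c₂ ω| ≤ 9 / (4 * t ^ 2) := fun ω => by
    simp only [c₂, Set.indicator_apply]
    split_ifs with h
    · have hfar : (2 * t / 3) ^ 2 ≤ (W ω - t) ^ 2 := by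
        have hNω : ¬(t / 3 ≤ W ω ∧ W ω ≤ 3 * t) := h.2
        by_cases h₁ : t / 3 ≤ W ω
        · have : 3 * t < W ω := by by_contra! h'; exact hNω ⟨h₁, h'⟩
          nlinarith
        · nlinarith
      rw [abs_of_nonneg (by positivity)]
      calc 1 / (W ω - t) ^ 2 ≤ 1 / (2 * t / 3) ^ 2 :=
            one_div_le_one_div_of_le (by positivity) hfar
        _ = 9 / (4 * t ^ 2) := by field_simp; norm_num
    · simp only [abs_zero]; positivity
  have hc₃0 : ∀ ω, 0 ≤ c₃ ω := fun ω => Set.indicator_nonneg (fun ω _ => by positivity) ω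
  have hc₃W : ∀ ω, c₃ ω ≤ 1 / (1 + ((W ω - t) / δ) ^ 2) := fun ω =>
    Set.indicator_le_self' (fun ω _ => by positivity) ω
  have hc₃b : ∀ ω, |c₃ ω| ≤ 1 := fun ω => by
    rw [abs_of_nonneg (hc₃0 ω)]
    refine (hc₃W ω).trans ?_
    rw [div_le_one (by positivity)]
    nlinarith [sq_nonneg ((W ω - t) / δ)]
  have hi : ∀ {c g : Ω → ℝ} {C : ℝ}, StronglyMeasurable[m] c → (∀ ω, |c ω| ≤ C) →
      Integrable g μ → Integrable (fun ω => c ω * g ω) μ := fun hc hC hg =>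
    hg.bdd_mul (hc.mono hm).aestronglyMeasurable (ae_of_all _ hC)
  have hiv : Integrable v μ := integrable_condExp
  have hiq : Integrable q μ := integrable_condExp
  have hpoint : ∀ ω, D ω ^ 2 * Set.indicator {ω' | |W ω' - t| ≤ |D ω'|} (fun _ => (1 : ℝ)) ω ≤
      c₀ ω * D ω ^ 2 + c₁ ω * D ω ^ 2 + c₂ ω * D ω ^ 4 +
        (c₃ ω * D ω ^ 2 + c₃ ω * D ω ^ 4 / δ ^ 2) := fun ω => by
    have hD20 := sq_nonneg (D ω)
    by_cases hev : |W ω - t| ≤ |D ω|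
    · by_cases h₁ : ω ∈ B₁
      · simp [c₀, c₁, c₂, c₃, h₁, hev]
      by_cases hN : ω ∈ N
      · by_cases h₂ : ω ∈ B₂
        · simp [c₀, c₁, c₂, c₃, h₁, hN, h₂, hev]
        · have := sq_le_kernel_mul hδ hev
          simp only [Set.indicator_apply, Set.mem_ofPred_eq, Set.mem_inter_iff, Set.mem_compl_iff,
            c₀, c₁, c₂, c₃, h₁, hN, h₂, hev, if_true, if_false, not_false_eq_true, and_self,
            not_true, and_false, zero_mul, mul_one, zero_add, mul_div_assoc, ← mul_add]
          exact this
      · have hne : W ω - t ≠ 0 := fun h => hN ⟨by linarith, by linarith⟩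
        simpa [c₀, c₁, c₂, c₃, h₁, hN, hev] using sq_le_inv_sq_mul hne hev
    · have hc₀0 : 0 ≤ c₀ ω := Set.indicator_nonneg (fun _ _ => zero_le_one) ω
      have hc₁0 : 0 ≤ c₁ ω := Set.indicator_nonneg (fun _ _ => zero_le_one) ω
      have hc₂0 : 0 ≤ c₂ ω := Set.indicator_nonneg (fun ω _ => by positivity) ω
      have := hc₃0 ω
      rw [Set.indicator_of_notMem (show ω ∉ {ω' | |W ω' - t| ≤ |D ω'|} from hev), mul_zero]
      positivity
  have hfar : ∫ ω, c₂ ω * q ω ∂μ ≤ 10 * lam ^ 2 * κ ^ 2 := by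
    have h := integral_mono (μ := μ) (hi hc₂m hc₂b hiq)
      (integrable_const (10 * lam ^ 2 * κ ^ 2)) fun ω => by
        by_cases h : ω ∈ B₁ᶜ ∩ Nᶜ
        · have hq := not_lt.1 (not_or.1 h.1).2
          simpa only [c₂, Set.indicator_of_mem h] using inv_sq_mul_le_of_far ht h.2 hq
        · simp only [c₂, Set.indicator_of_notMem h, zero_mul]
          positivity
    simpa using h
  have hbad : ∫ ω, c₁ ω * v ω ∂μ ≤ 8 * lam * (μ B₂).toReal * t := by
    have hB₂i : Integrable (B₂.indicator fun _ => 8 * lam * t) μ :=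
      (integrable_const _).indicator (hm _ hB₂m)
    have h := integral_mono (μ := μ) (hi hc₁m hc₁b hiv) hB₂i fun ω => by
      by_cases h : ω ∈ B₁ᶜ ∩ N ∩ B₂
      · have hv := not_lt.1 (not_or.1 h.1.1).1
        have hwt : W ω ≤ 3 * t := h.1.2.2
        simp only [c₁, Set.indicator_of_mem h, Set.indicator_of_mem h.2, one_mul]
        nlinarith
      · simp only [c₁, Set.indicator_of_notMem h, zero_mul]
        exact Set.indicator_nonneg (fun _ _ => by positivity) ω
    rw [integral_indicator_const _ (hm _ hB₂m), smul_eq_mul] at h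
    refine h.trans_eq ?_
    rw [measureReal_def]
    ring
  have hc₃v := integral_mul_condExp_of_bounded hm hc₃m hc₃b hD2
  have hc₃q := integral_mul_condExp_of_bounded hm hc₃m hc₃b hD4
  have hJeq : ∫ ω, c₃ ω * (D ω ^ 2 - D ω ^ 4 / δ ^ 2) ∂μ =
      ∫ ω, c₃ ω * v ω ∂μ - (∫ ω, c₃ ω * q ω ∂μ) / δ ^ 2 := by
    rw [hc₃v, hc₃q, ← integral_div, ← integral_sub (hi hc₃m hc₃b hD2)
      ((hi hc₃m hc₃b hD4).div_const _)]
    simp only [mul_sub, mul_div_assoc]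
  have hnear : ∫ ω, c₃ ω * v ω ∂μ + (∫ ω, c₃ ω * q ω ∂μ) / δ ^ 2 ≤
      234 / 7 * ∫ ω, c₃ ω * (D ω ^ 2 - D ω ^ 4 / δ ^ 2) ∂μ := by
    have hiv₃ := hi hc₃m hc₃b hiv
    have hiq₃ := (hi hc₃m hc₃b hiq).div_const (δ ^ 2)
    rw [hJeq, ← integral_div, ← integral_add hiv₃ hiq₃, ← integral_sub hiv₃ hiq₃,
      ← integral_const_mul]
    refine integral_mono (hiv₃.add hiq₃) ((hiv₃.sub hiq₃).const_mul _) fun ω => ?_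
    by_cases h : ω ∈ B₁ᶜ ∩ N ∩ B₂ᶜ
    · obtain ⟨h₁v, h₁q⟩ := not_or.1 h.1.1
      obtain ⟨h₂v, h₂q⟩ := not_or.1 h.2
      have := mul_le_mul_of_nonneg_left (moment_add_le_mul_moment_sub ht hκ hlam hδ2 h.1.2
        (not_lt.1 h₁v) (not_lt.1 h₁q) (not_lt.1 h₂v) (not_lt.1 h₂q)) (hc₃0 ω)
      simp only
      linear_combination this
    · simp [c₃, Set.indicator_of_notMem h]
  have hconc := integral_cauchy_kernel_le hm hWm hW' (fun ω => by simp [hDdef]) hdist hlam.le hδ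
    hD1 hD2 hD4 hW1 hcond hc₃m hc₃0 hc₃W
  have hε₁ : ∫ ω, c₀ ω * D ω ^ 2 ∂μ = ∫ ω, v ω * B₁.indicator (fun _ => (1 : ℝ)) ω ∂μ := by
    rw [← integral_mul_condExp_of_bounded hm hc₀m hc₀b hD2]
    simp only [c₀, hv_def, mul_comm]
  have hi₀ := hi hc₀m hc₀b hD2
  have hi₁ := hi hc₁m hc₁b hD2
  have hi₂ := hi hc₂m hc₂b hD4
  have hi₃ := hi hc₃m hc₃b hD2
  have hi₄ := (hi hc₃m hc₃b hD4).div_const (δ ^ 2)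
  have hi₀₁ : Integrable (fun ω => c₀ ω * D ω ^ 2 + c₁ ω * D ω ^ 2) μ := hi₀.add hi₁
  have hi₀₂ : Integrable (fun ω => c₀ ω * D ω ^ 2 + c₁ ω * D ω ^ 2 + c₂ ω * D ω ^ 4) μ :=
    hi₀₁.add hi₂
  have hi₃₄ : Integrable (fun ω => c₃ ω * D ω ^ 2 + c₃ ω * D ω ^ 4 / δ ^ 2) μ := hi₃.add hi₄
  have hmain := integral_mono_of_nonneg (ae_of_all μ fun ω => mul_nonneg (sq_nonneg (D ω))
      (Set.indicator_nonneg (fun _ _ => zero_le_one) ω))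
    (hi₀₂.add hi₃₄) (ae_of_all μ hpoint)
  simp only [Pi.add_apply] at hmain
  rw [integral_add hi₀₂ hi₃₄, integral_add hi₀₁ hi₂,
    integral_add hi₀ hi₁, integral_add hi₃ hi₄, integral_div, hε₁,
    ← integral_mul_condExp_of_bounded hm hc₁m hc₁b hD2,
    ← integral_mul_condExp_of_bounded hm hc₂m hc₂b hD4, ← hc₃v, ← hc₃q] at hmain
  have hE : 0 ≤ ∫ ω, |W ω - 1| ∂μ := integral_nonneg fun ω => abs_nonneg _
  have hscale := mul_le_mul_of_nonneg_right hδ3 hE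
  have hpos : 0 ≤ lam ^ ((3 : ℝ) / 2) * κ * √t * ∫ ω, |W ω - 1| ∂μ := by positivity
  have hsq : 0 ≤ lam ^ 2 * κ ^ 2 := by positivity
  linarith
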